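/- Let H and W be real Hilbert spaces, b : W × W → ℝ a bounded symmetric bilinear form with |b(u,v)| ≤ C_b‖u‖‖v‖ which is coercive, b(v,v) ≥ c₀‖v‖² with c₀ > 0, D : W → H a continuous linear operator, s : W × W → ℝ a bounded symmetric positive semidefinite bilinear form with |s(u,w)| ≤ C_s‖u‖‖w‖, λ > 0, and G, L continuous linear functionals on W. Suppose (f,u,y) ∈ H × W × W satisfies: (i) b(u,v) = ⟨f, Dv⟩_H + G(v) for all v ∈ W; (ii) b(w,y) + s(u,w) = L(w) for all w ∈ W; (iii) λ f = D y. Let (f_h,u_h,y_h) ∈ H × W × W be arbitrary, and define: f̃ := λ^{-1} D y_h; ũ ∈ W as the unique solution of b(ũ,v) = ⟨f_h, Dv⟩_H + G(v) for all v ∈ W; and ỹ ∈ W as the unique solution of b(w,ỹ) = L(w) − s(u_h,w) for all w ∈ W. Then the two quantities ‖f−f_h‖_H + ‖u−u_h‖_W + ‖y−y_h‖_W and ‖f̃−f_h‖_H + ‖ũ−u_h‖_W + ‖ỹ−y_h‖_W are equivalent, with equivalence constants depending only on λ, c₀, C_b, C_s and ‖D‖. -/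

import Mathlib

open scoped RealInnerProductSpace

/-- A nonnegative solution of `c x² ≤ a x` satisfies `x ≤ a / c`. -/
lemma le_div_of_mul_sq_le_mul {c a x : ℝ} (hc : 0 < c) (ha : 0 ≤ a) (hx : 0 ≤ x)
    (h : c * x ^ 2 ≤ a * x) : x ≤ a / c := by
  rcases hx.eq_or_lt with rfl | hx
  · positivity
  · rw [le_div_iff₀ hc]
    nlinarith

/-- A quadratic inequality `c x² ≤ p r x + q r²` bounds `x` linearly by `r`. -/
lemma le_mul_of_mul_sq_le_add {c p q r x : ℝ} (hc : 0 < c) (hp : 0 ≤ p) (hq : 0 ≤ q)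
    (hr : 0 ≤ r) (hx : 0 ≤ x) (h : c * x ^ 2 ≤ p * r * x + q * r ^ 2) :
    x ≤ (1 + (p + q) / c) * r := by
  have hpq : 0 ≤ (p + q) / c * r := by positivity
  rcases le_total x r with hxr | hrx
  · linarith
  · have hle : q * r ^ 2 ≤ q * r * x := by
      nlinarith [mul_le_mul_of_nonneg_left hrx (mul_nonneg hq hr)]
    have := le_div_of_mul_sq_le_mul (a := (p + q) * r) hc (by positivity) hx (by linarith)
    rw [mul_div_right_comm] at this
    linarith

/-- Abstract core of the a posteriori error estimate (Theorem 5 of the paper): for any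
approximation `(f_h, u_h, y_h)` of the exact solution `(f, u, y)` of the optimality
system, the total error `‖f−f_h‖ + ‖u−u_h‖ + ‖y−y_h‖` is equivalent, with constants
depending only on `λ, c₀, C_b, C_s` and a bound `C_D` on `‖D‖`, to the distance
`‖f̃−f_h‖ + ‖ũ−u_h‖ + ‖ỹ−y_h‖` to the auxiliary exact solves with discrete data. -/
theorem aposteriori_error_equivalence
    {H W : Type*}
    [NormedAddCommGroup H] [InnerProductSpace ℝ H] [CompleteSpace H]
    [NormedAddCommGroup W] [InnerProductSpace ℝ W] [CompleteSpace W]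
    (lam c₀ C_b C_s C_D : ℝ) (hlam : 0 < lam) (hc₀ : 0 < c₀) :
    ∃ C₁ C₂ : ℝ, 0 < C₁ ∧ 0 < C₂ ∧
      ∀ (b : W →ₗ[ℝ] W →ₗ[ℝ] ℝ) (D : W →L[ℝ] H) (s : W →ₗ[ℝ] W →ₗ[ℝ] ℝ)
        (G L : W →L[ℝ] ℝ),
        (∀ u v : W, |b u v| ≤ C_b * ‖u‖ * ‖v‖) →
        (∀ u v : W, b u v = b v u) →
        (∀ v : W, c₀ * ‖v‖ ^ 2 ≤ b v v) →
        ‖D‖ ≤ C_D →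
        (∀ u v : W, |s u v| ≤ C_s * ‖u‖ * ‖v‖) →
        (∀ u v : W, s u v = s v u) →
        (∀ v : W, 0 ≤ s v v) →
        ∀ (f : H) (u y : W) (f_h : H) (u_h y_h : W) (ft : H) (ut yt : W),
          (∀ v : W, b u v = ⟪f, D v⟫ + G v) →
          (∀ w : W, b w y + s u w = L w) →
          lam • f = D y →
          ft = lam⁻¹ • D y_h →
          (∀ v : W, b ut v = ⟪f_h, D v⟫ + G v) →
          (∀ w : W, b w yt = L w - s u_h w) →
          ‖f - f_h‖ + ‖u - u_h‖ + ‖y - y_h‖ ≤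
              C₁ * (‖ft - f_h‖ + ‖ut - u_h‖ + ‖yt - y_h‖) ∧
          ‖ft - f_h‖ + ‖ut - u_h‖ + ‖yt - y_h‖ ≤
              C₂ * (‖f - f_h‖ + ‖u - u_h‖ + ‖y - y_h‖) := by
  set B := |C_b|
  set K := |C_D| / c₀ with hK
  set M := |C_s| / c₀ with hM
  set t := 1 + (lam + B * K + B * M * K + B * (2 + M)) / lam
  have hB0 : 0 ≤ B := abs_nonneg _
  have hK0 : 0 ≤ K := by positivity
  have hM0 : 0 ≤ M := by positivity
  have ht0 : 0 < t := by positivity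
  refine ⟨t + (1 + K * t) + (1 + M * (1 + K * t)), 1 + K + M + |C_D| / lam, by positivity,
    by positivity, ?_⟩
  intro b D s G L hb hbsymm hcoer hD hs hssymm hspos f u y f_h u_h y_h ft ut yt
    hu hy hf hft hut hyt
  have hb' (v w : W) : |b v w| ≤ B * ‖v‖ * ‖w‖ :=
    (hb v w).trans (by gcongr; exact le_abs_self _)
  have hs' (v w : W) : |s v w| ≤ |C_s| * ‖v‖ * ‖w‖ :=
    (hs v w).trans (by gcongr; exact le_abs_self _)
  have hD' (v : W) : ‖D v‖ ≤ |C_D| * ‖v‖ :=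
    D.le_of_opNorm_le (hD.trans (le_abs_self _)) v
  have hdu (v : W) : b (u - ut) v = ⟪f - f_h, D v⟫ := by
    rw [map_sub, LinearMap.sub_apply, hu, hut, inner_sub_left]
    ring
  have hdy (w : W) : b w (y - yt) = -s (u - u_h) w := by
    rw [map_sub, hyt, map_sub, LinearMap.sub_apply]
    linarith [hy w]
  have hdf : f - ft = lam⁻¹ • D (y - y_h) := by
    rw [hft, map_sub, smul_sub, ← hf, inv_smul_smul₀ hlam.ne']
  have hdf_norm : ‖f - ft‖ ≤ |C_D| / lam * ‖y - y_h‖ := by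
    rw [hdf, norm_smul, norm_inv, Real.norm_of_nonneg hlam.le, div_mul_eq_mul_div,
      div_eq_inv_mul]
    gcongr
    exact hD' _
  have hdu_norm : ‖u - ut‖ ≤ K * ‖f - f_h‖ := by
    rw [hK, div_mul_eq_mul_div]
    refine le_div_of_mul_sq_le_mul hc₀ (by positivity) (norm_nonneg _) ?_
    calc c₀ * ‖u - ut‖ ^ 2 ≤ ⟪f - f_h, D (u - ut)⟫ := (hcoer _).trans_eq (hdu _)
      _ ≤ ‖f - f_h‖ * ‖D (u - ut)‖ := real_inner_le_norm _ _
      _ ≤ ‖f - f_h‖ * (|C_D| * ‖u - ut‖) := by gcongr; exact hD' _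
      _ = |C_D| * ‖f - f_h‖ * ‖u - ut‖ := by ring
  have hdy_norm : ‖y - yt‖ ≤ M * ‖u - u_h‖ := by
    rw [hM, div_mul_eq_mul_div]
    refine le_div_of_mul_sq_le_mul hc₀ (by positivity) (norm_nonneg _) ?_
    calc c₀ * ‖y - yt‖ ^ 2 ≤ -s (u - u_h) (y - yt) := (hcoer _).trans_eq (hdy _)
      _ ≤ |s (u - u_h) (y - yt)| := neg_le_abs _
      _ ≤ |C_s| * ‖u - u_h‖ * ‖y - yt‖ := hs' _ _
  have hEf := norm_nonneg (f - f_h)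
  have hEu := norm_nonneg (u - u_h)
  have hEy := norm_nonneg (y - y_h)
  have hRf := norm_nonneg (ft - f_h)
  have hRu := norm_nonneg (ut - u_h)
  have hRy := norm_nonneg (yt - y_h)
  constructor
  · set R := ‖ft - f_h‖ + ‖ut - u_h‖ + ‖yt - y_h‖
    have hR0 : 0 ≤ R := by positivity
    have hu_le : ‖u - u_h‖ ≤ R + K * ‖f - f_h‖ := by
      linarith [norm_sub_le_norm_sub_add_norm_sub u ut u_h]
    have hy_le : ‖y - y_h‖ ≤ R + M * ‖u - u_h‖ := by
      linarith [norm_sub_le_norm_sub_add_norm_sub y yt y_h]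
    have energy : lam * ‖f - f_h‖ ^ 2 + s (u - u_h) (u - u_h) =
        lam * ⟪f - f_h, ft - f_h⟫ + b (u - u_h) (yt - y_h) - b (ut - u_h) (y - y_h) := by
      have hf_split : lam • (f - f_h) = lam • (ft - f_h) + D (y - y_h) := by
        rw [← sub_add_sub_cancel f ft f_h, hdf, smul_add, smul_inv_smul₀ hlam.ne', add_comm]
      have hinner := congrArg (fun z => ⟪f - f_h, z⟫) hf_split
      simp only [inner_add_right, real_inner_smul_right, real_inner_self_eq_norm_sq,
        ← hdu] at hinner
      have hb_left : b (u - u_h) (y - y_h) =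
          b (u - ut) (y - y_h) + b (ut - u_h) (y - y_h) := by
        rw [← LinearMap.add_apply, ← map_add, sub_add_sub_cancel]
      have hb_right : b (u - u_h) (y - y_h) =
          b (u - u_h) (y - yt) + b (u - u_h) (yt - y_h) := by
        rw [← map_add, sub_add_sub_cancel]
      linarith [hdy (u - u_h)]
    have hf_le : ‖f - f_h‖ ≤ t * R := by
      have hinner : ⟪f - f_h, ft - f_h⟫ ≤ ‖f - f_h‖ * R :=
        (real_inner_le_norm _ _).trans (by gcongr; linarith)
      have hbu : b (u - u_h) (yt - y_h) ≤ B * (R + K * ‖f - f_h‖) * R :=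
        (le_abs_self _).trans ((hb' _ _).trans (by gcongr; linarith))
      have hby : -b (ut - u_h) (y - y_h) ≤ B * R * (R + M * (R + K * ‖f - f_h‖)) :=
        (neg_le_abs _).trans ((hb' _ _).trans (by
          gcongr
          · linarith
          · exact hy_le.trans (by gcongr)))
      refine le_mul_of_mul_sq_le_add (p := lam + B * K + B * M * K) (q := B * (2 + M)) hlam
        (by positivity) (by positivity) hR0 hEf ?_
      linarith [mul_le_mul_of_nonneg_left hinner hlam.le, hspos (u - u_h)]
    have hu_le' : ‖u - u_h‖ ≤ (1 + K * t) * R := by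
      linarith [mul_le_mul_of_nonneg_left hf_le hK0]
    linarith [mul_le_mul_of_nonneg_left hu_le' hM0]
  · have hf_tri := norm_sub_le_norm_sub_add_norm_sub ft f f_h
    have hu_tri := norm_sub_le_norm_sub_add_norm_sub ut u u_h
    have hy_tri := norm_sub_le_norm_sub_add_norm_sub yt y y_h
    rw [norm_sub_rev ft f] at hf_tri
    rw [norm_sub_rev ut u] at hu_tri
    rw [norm_sub_rev yt y] at hy_tri
    have hN0 : 0 ≤ |C_D| / lam := by positivity
    linarith [mul_nonneg hK0 hEu, mul_nonneg hK0 hEy, mul_nonneg hM0 hEf, mul_nonneg hM0 hEy,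
      mul_nonneg hN0 hEf, mul_nonneg hN0 hEu]
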